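/- Let N ≥ 1 and r ≥ 0 be integers. There exists a constant C, depending only on N and r, such that for every x₀ ∈ ℝ^N and every h > 0 there is a smooth function δ̃ : ℝ^N → ℝ with the following properties: (i) the support of δ̃ is contained in the closed ball of radius h centered at x₀; (ii) ∫_{ℝ^N} δ̃(x) q(x) dx = q(x₀) for every polynomial q on ℝ^N of total degree at most r; (iii) for every 1 ≤ p ≤ ∞, ‖δ̃‖_{L^p(ℝ^N)} ≤ C h^{−N(1−1/p)} and ‖∇δ̃‖_{L^p(ℝ^N)} ≤ C h^{−1−N(1−1/p)}. -/

import Mathlib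

open MeasureTheory Real
open scoped ENNReal NNReal

lemma sd_evalContDiff {N : ℕ} (q : MvPolynomial (Fin N) ℝ) :
    ContDiff ℝ (⊤ : ℕ∞) (fun x : EuclideanSpace ℝ (Fin N) => MvPolynomial.eval (fun i => x i) q) := by
  induction q using MvPolynomial.induction_on with
  | C a => simpa using contDiff_const
  | add p q hp hq => simpa using hp.add hq
  | mul_X p i hp =>
    simp only [map_mul, MvPolynomial.eval_X]
    refine hp.mul ?_
    fun_prop

lemma sd_totalDegree_bind {N : ℕ} (q : MvPolynomial (Fin N) ℝ) (f : Fin N → MvPolynomial (Fin N) ℝ)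
    (hf : ∀ i, (f i).totalDegree ≤ 1) :
    (MvPolynomial.bind₁ f q).totalDegree ≤ q.totalDegree := by
  conv_lhs => rw [q.as_sum, map_sum]
  refine MvPolynomial.totalDegree_finsetSum_le fun s hs => ?_
  rw [MvPolynomial.bind₁_monomial]
  refine (MvPolynomial.totalDegree_mul _ _).trans ?_
  rw [MvPolynomial.totalDegree_C, zero_add]
  refine (MvPolynomial.totalDegree_finsetProd _ _).trans ?_
  refine le_trans ?_ (MvPolynomial.le_totalDegree hs)
  refine Finset.sum_le_sum fun i _ => ?_
  refine (MvPolynomial.totalDegree_pow _ _).trans ?_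
  exact (Nat.mul_le_mul_left _ (hf i)).trans (by simp)

lemma sd_eq_zero {N : ℕ} (p : MvPolynomial (Fin N) ℝ) (ε : ℝ) (hε : 0 < ε)
    (hp : ∀ x ∈ Metric.ball (0 : EuclideanSpace ℝ (Fin N)) ε,
      MvPolynomial.eval (fun i => x i) p = 0) : p = 0 := by
  have hopen : IsOpen ((fun x : Fin N → ℝ => (WithLp.toLp 2 x : EuclideanSpace ℝ (Fin N))) ⁻¹'
      Metric.ball 0 ε) :=
    Metric.isOpen_ball.preimage (PiLp.continuous_toLp 2 _)
  obtain ⟨η, hη, hsub⟩ := Metric.isOpen_iff.1 hopen 0 (by simpa using hε)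
  refine MvPolynomial.funext_set (fun _ => Metric.ball (0 : ℝ) η) (fun _ => ?_) ?_
  · rw [Real.ball_eq_Ioo]
    exact Set.Ioo_infinite (by linarith)
  · intro x hx
    have : x ∈ Metric.ball (0 : Fin N → ℝ) η := by
      rw [ball_pi _ hη]; exact hx
    simpa using hp _ (hsub this)

lemma sd_ref (N r : ℕ) : ∃ ψ : EuclideanSpace ℝ (Fin N) → ℝ,
    ContDiff ℝ (⊤ : ℕ∞) ψ ∧ tsupport ψ ⊆ Metric.closedBall 0 1 ∧
    ∀ q : MvPolynomial (Fin N) ℝ, q.totalDegree ≤ r →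
      ∫ x, ψ x * MvPolynomial.eval (fun i => x i) q = MvPolynomial.eval (fun _ => 0) q := by
  let φ : ContDiffBump (0 : EuclideanSpace ℝ (Fin N)) := ⟨1/2, 1, by norm_num, by norm_num⟩
  let ev : MvPolynomial (Fin N) ℝ → EuclideanSpace ℝ (Fin N) → ℝ :=
    fun q x => MvPolynomial.eval (fun i => x i) q
  have hev : ∀ q, Continuous (ev q) := fun q => (sd_evalContDiff q).continuous
  have hφc : Continuous φ := φ.continuous
  have hcs : ∀ p q, HasCompactSupport (fun x => φ x * ev p x * ev q x) := fun p q =>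
    (φ.hasCompactSupport.mul_right (f' := ev p)).mul_right (f' := ev q)
  have hcont : ∀ p q, Continuous (fun x => φ x * ev p x * ev q x) := fun p q =>
    (hφc.mul (hev p)).mul (hev q)
  have hint : ∀ p q, Integrable (fun x => φ x * ev p x * ev q x) := fun p q =>
    (hcont p q).integrable_of_hasCompactSupport (hcs p q)
  let B : MvPolynomial (Fin N) ℝ →ₗ[ℝ] MvPolynomial (Fin N) ℝ →ₗ[ℝ] ℝ :=
    LinearMap.mk₂ ℝ (fun p q => ∫ x, φ x * ev p x * ev q x)
      (by
        intro p p' q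
        rw [← integral_add (hint _ _) (hint _ _)]
        congr 1; ext x; simp only [ev, map_add]; ring)
      (by
        intro c p q
        rw [smul_eq_mul, ← integral_const_mul]
        congr 1; ext x; simp only [ev, MvPolynomial.smul_eval]; ring)
      (by
        intro p q q'
        rw [← integral_add (hint _ _) (hint _ _)]
        congr 1; ext x; simp only [ev, map_add]; ring)
      (by
        intro c p q
        rw [smul_eq_mul, ← integral_const_mul]
        congr 1; ext x; simp only [ev, MvPolynomial.smul_eval]; ring)
  let V := MvPolynomial.restrictTotalDegree (Fin N) ℝ r
  let T : V →ₗ[ℝ] Module.Dual ℝ V := B.domRestrict₁₂ V V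
  have hT : Function.Injective T := by
    rw [← LinearMap.ker_eq_bot, LinearMap.ker_eq_bot']
    intro p hp
    have h0 : ∫ x, φ x * ev p x * ev p x = 0 := by
      exact LinearMap.congr_fun hp p
    apply Subtype.ext
    refine sd_eq_zero p.1 (1/2) (by norm_num) fun x hx => ?_
    by_contra hne
    have hx1 : φ x = 1 := φ.one_of_mem_closedBall (Metric.ball_subset_closedBall hx)
    have := (hcont p p).integral_pos_of_hasCompactSupport_nonneg_nonzero (μ := volume) (hcs p p)
      (fun y => by
        have := φ.nonneg (x := y)
        have := mul_nonneg this (mul_self_nonneg (ev p y))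
        simpa [mul_assoc] using this) (x := x)
      (by rw [hx1]; simpa [ev] using hne)
    linarith
  have hsurj : Function.Surjective T :=
    (LinearMap.injective_iff_surjective_of_finrank_eq_finrank
      (Subspace.dual_finrank_eq (K := ℝ) (V := V)).symm).1 hT
  obtain ⟨p, hp⟩ := hsurj
    ((MvPolynomial.aeval (R := ℝ) (fun _ : Fin N => (0:ℝ))).toLinearMap.domRestrict V)
  refine ⟨fun x => φ x * ev p x, φ.contDiff.mul (sd_evalContDiff p.1), ?_, ?_⟩
  · refine (tsupport_mul_subset_left).trans ?_
    rw [φ.tsupport_eq]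
  · intro q hq
    have h1 : ∫ x, φ x * ev p x * ev q x = MvPolynomial.aeval (R := ℝ) (fun _ : Fin N => (0:ℝ)) q :=
      LinearMap.congr_fun hp ⟨q, (MvPolynomial.mem_restrictTotalDegree _ _ _).2 hq⟩
    rw [MvPolynomial.aeval_eq_eval] at h1
    exact h1

lemma sd_bound {N : ℕ} {F : Type*} [NormedAddCommGroup F] (g : EuclideanSpace ℝ (Fin N) → F)
    (x₀ : EuclideanSpace ℝ (Fin N)) (h M : ℝ) (hh : 0 < h) (hM : 0 ≤ M) (a : ℝ)
    (hs : Function.support g ⊆ Metric.closedBall x₀ h) (hb : ∀ x, ‖g x‖ ≤ M * h ^ (a - N))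
    (p : ℝ≥0∞) (hp : 1 ≤ p) :
    eLpNorm g p volume ≤ ENNReal.ofReal
      (M * max 1 (volume (Metric.closedBall (0 : EuclideanSpace ℝ (Fin N)) 1)).toReal
        * h ^ (a - (N : ℝ) * (1 - 1 / p.toReal))) := by
  set v := (volume (Metric.closedBall (0 : EuclideanSpace ℝ (Fin N)) 1)).toReal with hv
  have hv0 : 0 ≤ v := ENNReal.toReal_nonneg
  have ht0 : 0 ≤ p.toReal⁻¹ := by positivity
  have ht1 : p.toReal⁻¹ ≤ 1 := by
    rcases eq_or_ne p ⊤ with rfl | hpt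
    · simp
    · apply inv_le_one_of_one_le₀
      simpa using ENNReal.toReal_mono hpt hp
  have hvol : volume (Metric.closedBall x₀ h) = ENNReal.ofReal (h ^ (N:ℝ) * v) := by
    rw [Measure.addHaar_closedBall' _ _ hh.le, ENNReal.ofReal_mul (by positivity), hv,
      ENNReal.ofReal_toReal measure_closedBall_lt_top.ne]
    simp
  rw [← eLpNorm_restrict_eq_of_support_subset hs]
  refine (eLpNorm_le_of_ae_bound (ae_of_all _ hb)).trans ?_
  rw [Measure.restrict_apply_univ, hvol, ENNReal.ofReal_rpow_of_nonneg (by positivity) ht0,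
    ← ENNReal.ofReal_mul (by positivity)]
  apply ENNReal.ofReal_le_ofReal
  rw [Real.mul_rpow (by positivity) hv0, ← Real.rpow_mul hh.le]
  have hvv : v ^ p.toReal⁻¹ ≤ max 1 v := by
    calc v ^ p.toReal⁻¹ ≤ (max 1 v) ^ p.toReal⁻¹ :=
          Real.rpow_le_rpow hv0 (le_max_right _ _) ht0
      _ ≤ (max 1 v) ^ (1:ℝ) := Real.rpow_le_rpow_of_exponent_le (le_max_left _ _) ht1
      _ = _ := Real.rpow_one _
  have e : a - (N : ℝ) * (1 - 1 / p.toReal) = (N * p.toReal⁻¹) + (a - N) := by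
    rw [one_div]; ring
  rw [e, Real.rpow_add hh]
  calc _ = M * (h ^ (N * p.toReal⁻¹) * h ^ (a - N)) * v ^ p.toReal⁻¹ := by ring
    _ ≤ M * (h ^ (N * p.toReal⁻¹) * h ^ (a - N)) * max 1 v := by gcongr
    _ = _ := by ring

/-- Existence of the smoothed Dirac delta δ̃ of (3.2)–(3.3): a smooth function
    supported in the ball of radius h around x₀ which reproduces point evaluation
    at x₀ on polynomials of total degree ≤ r and satisfies the scaled bounds
    ‖δ̃‖_{L^p} ≤ C h^{−N(1−1/p)} and ‖∇δ̃‖_{L^p} ≤ C h^{−1−N(1−1/p)}. -/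
theorem smoothed_delta_exists (N r : ℕ) (hN : 1 ≤ N) :
    ∃ C : ℝ, 0 < C ∧
      ∀ (x₀ : EuclideanSpace ℝ (Fin N)) (h : ℝ), 0 < h →
        ∃ δ : EuclideanSpace ℝ (Fin N) → ℝ,
          ContDiff ℝ (⊤ : ℕ∞) δ ∧
          tsupport δ ⊆ Metric.closedBall x₀ h ∧
          (∀ q : MvPolynomial (Fin N) ℝ, q.totalDegree ≤ r →
            ∫ x, δ x * MvPolynomial.eval (fun i => x i) q =
              MvPolynomial.eval (fun i => x₀ i) q) ∧
          (∀ p : ℝ≥0∞, 1 ≤ p →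
            eLpNorm δ p volume ≤
              ENNReal.ofReal (C * h ^ (-(N : ℝ) * (1 - 1 / p.toReal))) ∧
            eLpNorm (fun x => ‖fderiv ℝ δ x‖) p volume ≤
              ENNReal.ofReal (C * h ^ (-1 - (N : ℝ) * (1 - 1 / p.toReal)))) := by
  obtain ⟨ψ, hψ, hsupp, hrep⟩ := sd_ref N r
  have hψcs : HasCompactSupport ψ :=
    HasCompactSupport.of_support_subset_isCompact (isCompact_closedBall 0 1)
      ((subset_tsupport ψ).trans hsupp)
  obtain ⟨M₀, hM₀⟩ := hψcs.exists_bound_of_continuous hψ.continuous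
  obtain ⟨M₁, hM₁⟩ := (hψcs.fderiv (𝕜 := ℝ)).exists_bound_of_continuous
    (hψ.continuous_fderiv (by simp))
  set M := max 1 (max M₀ M₁) with hM
  have hMpos : 0 < M := lt_of_lt_of_le one_pos (le_max_left _ _)
  have hb0 : ∀ x, ‖ψ x‖ ≤ M := fun x =>
    (hM₀ x).trans ((le_max_left _ _).trans (le_max_right _ _))
  have hb1 : ∀ x, ‖fderiv ℝ ψ x‖ ≤ M := fun x =>
    (hM₁ x).trans ((le_max_right _ _).trans (le_max_right _ _))
  refine ⟨M * max 1 (volume (Metric.closedBall (0 : EuclideanSpace ℝ (Fin N)) 1)).toReal,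
    by positivity, ?_⟩
  intro x₀ h hh
  set δ : EuclideanSpace ℝ (Fin N) → ℝ := fun x => (h ^ N)⁻¹ * ψ (h⁻¹ • (x - x₀)) with hδ
  have hts : tsupport δ ⊆ Metric.closedBall x₀ h := by
    refine closure_minimal (fun x hx => ?_) Metric.isClosed_closedBall
    have h1 : ψ (h⁻¹ • (x - x₀)) ≠ 0 := fun h0 => hx (by simp [hδ, h0])
    have h2 := hsupp (subset_tsupport _ h1)
    rw [mem_closedBall_zero_iff, norm_smul, norm_inv, Real.norm_of_nonneg hh.le,
      inv_mul_le_iff₀ hh, mul_one] at h2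
    rwa [mem_closedBall_iff_norm]
  have hd : ∀ x, HasFDerivAt δ ((h ^ N)⁻¹ • h⁻¹ • fderiv ℝ ψ (h⁻¹ • (x - x₀))) x := by
    intro x
    have h1 : HasFDerivAt (fun x : EuclideanSpace ℝ (Fin N) => h⁻¹ • (x - x₀))
        (h⁻¹ • ContinuousLinearMap.id ℝ _) x := ((hasFDerivAt_id x).sub_const x₀).const_smul h⁻¹
    have h2 := ((hψ.differentiable (by simp)) (h⁻¹ • (x - x₀))).hasFDerivAt.comp x h1
    have h3 := h2.const_mul ((h ^ N)⁻¹)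
    have h4 : (h ^ N)⁻¹ • h⁻¹ • fderiv ℝ ψ (h⁻¹ • (x - x₀)) = (h ^ N)⁻¹ •
        (fderiv ℝ ψ (h⁻¹ • (x - x₀))).comp (h⁻¹ • ContinuousLinearMap.id ℝ _) := by
      ext y
      simp
    rw [h4]
    exact h3
  refine ⟨δ, ?_, hts, ?_, ?_⟩
  · exact contDiff_const.mul (hψ.comp ((contDiff_id.sub contDiff_const).const_smul h⁻¹))
  · intro q hq
    let f : Fin N → MvPolynomial (Fin N) ℝ :=
      fun i => MvPolynomial.C (x₀ i) + MvPolynomial.C h * MvPolynomial.X i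
    have hf : ∀ i, (f i).totalDegree ≤ 1 := by
      intro i
      refine (MvPolynomial.totalDegree_add _ _).trans (max_le (by simp) ?_)
      exact (MvPolynomial.totalDegree_mul _ _).trans (by simp)
    have hfe : ∀ y : Fin N → ℝ, MvPolynomial.eval y (MvPolynomial.bind₁ f q) =
        MvPolynomial.eval (fun i => x₀ i + h * y i) q := by
      intro y
      rw [← MvPolynomial.coe_aeval_eq_eval, ← MvPolynomial.coe_aeval_eq_eval]
      simp only [RingHom.coe_coe, MvPolynomial.aeval_bind₁]
      simp [f]
    have key := hrep (MvPolynomial.bind₁ f q) ((sd_totalDegree_bind q f hf).trans hq)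
    simp only [hfe] at key
    calc ∫ x, δ x * MvPolynomial.eval (fun i => x i) q
        = ∫ x, (fun z : EuclideanSpace ℝ (Fin N) => (h ^ N)⁻¹ * (ψ (h⁻¹ • z) *
            MvPolynomial.eval (fun i => x₀ i + z i) q)) (x - x₀) := by
          congr 1; ext x; simp [hδ, mul_assoc]
      _ = ∫ z : EuclideanSpace ℝ (Fin N), (h ^ N)⁻¹ * (ψ (h⁻¹ • z) *
            MvPolynomial.eval (fun i => x₀ i + z i) q) :=
          integral_sub_right_eq_self
            (fun z : EuclideanSpace ℝ (Fin N) => (h ^ N)⁻¹ * (ψ (h⁻¹ • z) *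
            MvPolynomial.eval (fun i => x₀ i + z i) q)) x₀
      _ = (h ^ N)⁻¹ * ∫ z : EuclideanSpace ℝ (Fin N), (fun y : EuclideanSpace ℝ (Fin N) => ψ y *
            MvPolynomial.eval (fun i => x₀ i + h * y i) q) (h⁻¹ • z) := by
          rw [integral_const_mul]
          congr 2; ext z
          simp [mul_inv_cancel_left₀ hh.ne']
      _ = _ := by
          rw [Measure.integral_comp_inv_smul_of_nonneg volume
            (fun y : EuclideanSpace ℝ (Fin N) => ψ y *
              MvPolynomial.eval (fun i => x₀ i + h * y i) q) hh.le, key]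
          simp [hh.ne']
  · intro p hp
    constructor
    · have := sd_bound δ x₀ h M hh hMpos.le 0 ((subset_tsupport δ).trans hts) (fun x => ?_) p hp
      · convert this using 4
        ring
      · rw [hδ, zero_sub, Real.rpow_neg hh.le, Real.rpow_natCast, norm_mul,
          Real.norm_of_nonneg (by positivity), mul_comm]
        gcongr
        exact hb0 _
    · rw [eLpNorm_norm]
      refine sd_bound (fderiv ℝ δ) x₀ h M hh hMpos.le (-1)
        ((support_fderiv_subset ℝ).trans hts) (fun x => ?_) p hp
      have e : h ^ (-1 - (N:ℝ)) = (h ^ N)⁻¹ * h⁻¹ := by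
        rw [sub_eq_add_neg, Real.rpow_add hh, Real.rpow_neg_one, Real.rpow_neg hh.le,
          Real.rpow_natCast, mul_comm]
      rw [(hd x).fderiv, norm_smul, norm_smul, Real.norm_of_nonneg (by positivity),
        Real.norm_of_nonneg (by positivity), e, mul_comm M, mul_assoc]
      gcongr
      exact hb1 _
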